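/- Let H₀, H₁, H₂ be finite-dimensional ℝ-vector spaces, each equipped with a real Hodge structure of weight 1, given by subspaces Fᵢ ⊆ ℂ ⊗_ℝ Hᵢ with ℂ ⊗_ℝ Hᵢ = Fᵢ ⊕ σ(Fᵢ). Let u ∈ H₀ ⊗_ℝ H₁ be such that its image in (ℂ⊗H₀) ⊗_ℂ (ℂ⊗H₁) lies in F₀ ⊗ σ(F₁) ⊕ σ(F₀) ⊗ F₁, and for j = 1, …, r let v_j ∈ H₁ ⊗_ℝ H₂ be such that their images in (ℂ⊗H₁) ⊗_ℂ (ℂ⊗H₂) lie in F₁ ⊗ σ(F₂) ⊕ σ(F₁) ⊗ F₂. Then, inside H₀ ⊗_ℝ H₁ ⊗_ℝ H₂, the intersection of the subspace (ℝ·u) ⊗ H₂ with the subspace H₀ ⊗ span_ℝ{v₁, …, v_r} is zero. -/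

import Mathlib

open TensorProduct

/-- The complex-conjugation involution `σ` of `ℂ ⊗_ℝ H`, determined by `z ⊗ h ↦ z̄ ⊗ h`,
as a `conj`-semilinear map. -/
noncomputable def sigmaR (H : Type*) [AddCommGroup H] [Module ℝ H] :
    (ℂ ⊗[ℝ] H) →ₛₗ[starRingEnd ℂ] (ℂ ⊗[ℝ] H) where
  toFun := TensorProduct.map Complex.conjAe.toLinearMap LinearMap.id
  map_add' := by simp
  map_smul' := by
    intro c x
    induction x using TensorProduct.induction_on with
    | zero => simp
    | tmul z h => simp [TensorProduct.smul_tmul', smul_eq_mul, map_mul]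
    | add x y hx hy => simp_all [smul_add]

/-- The canonical isomorphism `ℂ ⊗_ℝ (H ⊗_ℝ H') ≅ (ℂ ⊗_ℝ H) ⊗_ℂ (ℂ ⊗_ℝ H')`. -/
noncomputable def distribR (H H' : Type*) [AddCommGroup H] [Module ℝ H]
    [AddCommGroup H'] [Module ℝ H'] :
    (ℂ ⊗[ℝ] (H ⊗[ℝ] H')) ≃ₗ[ℂ] (ℂ ⊗[ℝ] H) ⊗[ℂ] (ℂ ⊗[ℝ] H') :=
  TensorProduct.AlgebraTensorModule.distribBaseChange ℝ ℂ H H'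

/-- The subspace `A ⊗ B` of `M ⊗[ℂ] N`, for `ℂ`-subspaces `A ⊆ M`, `B ⊆ N`. -/
noncomputable def tensorSub {M N : Type*} [AddCommGroup M] [Module ℂ M]
    [AddCommGroup N] [Module ℂ N] (A : Submodule ℂ M) (B : Submodule ℂ N) :
    Submodule ℂ (M ⊗[ℂ] N) :=
  Submodule.map₂ (TensorProduct.mk ℂ M N) A B

/-- Contraction of the left factor of a tensor product against a linear form. -/
noncomputable def contractLeftForm {K M : Type*} (N : Type*) [Field K] [AddCommGroup M] [Module K M]
    [AddCommGroup N] [Module K N] (f : M →ₗ[K] K) : M ⊗[K] N →ₗ[K] N :=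
  TensorProduct.lid K N ∘ₗ f.rTensor N

theorem eq_zero_of_forall_contractLeftForm {K M N : Type*} [Field K] [AddCommGroup M] [Module K M]
    [AddCommGroup N] [Module K N] {u : M ⊗[K] N}
    (h : ∀ f : M →ₗ[K] K, contractLeftForm N f u = 0) : u = 0 := by
  classical
  let b := Module.Basis.ofVectorSpace K M
  apply (TensorProduct.equivFinsuppOfBasisLeft b).injective
  ext i
  simpa [contractLeftForm, TensorProduct.equivFinsuppOfBasisLeft_apply] using h (b.coord i)

theorem tmul_eq_zero_or_eq_zero {K M N : Type*} [Field K] [AddCommGroup M] [Module K M]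
    [AddCommGroup N] [Module K N] {m : M} {n : N} (h : m ⊗ₜ[K] n = 0) : m = 0 ∨ n = 0 := by
  by_contra! hmn
  refine hmn.1 ((Module.forall_dual_apply_eq_zero_iff K m).mp fun f ↦ ?_)
  have hf : f m • n = 0 := by simpa [contractLeftForm] using congrArg (contractLeftForm N f) h
  exact (smul_eq_zero.mp hf).resolve_right hmn.2

theorem rTensor_contractLeftForm_assoc_symm {K M N P : Type*} [Field K] [AddCommGroup M]
    [Module K M] [AddCommGroup N] [Module K N] [AddCommGroup P] [Module K P]
    (f : M →ₗ[K] K) (y : M) (t : N ⊗[K] P) :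
    (contractLeftForm N f).rTensor P ((TensorProduct.assoc K M N P).symm (y ⊗ₜ t)) = f y • t := by
  induction t using TensorProduct.induction_on with
  | zero => simp
  | tmul a b => simp [contractLeftForm, TensorProduct.smul_tmul']
  | add a b ha hb => simp [TensorProduct.tmul_add, ha, hb]

theorem sigmaR_one_tmul {H : Type*} [AddCommGroup H] [Module ℝ H] (h : H) :
    sigmaR H ((1 : ℂ) ⊗ₜ[ℝ] h) = 1 ⊗ₜ h := by
  simp [sigmaR]

theorem sigmaR_sigmaR {H : Type*} [AddCommGroup H] [Module ℝ H] (x : ℂ ⊗[ℝ] H) :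
    sigmaR H (sigmaR H x) = x := by
  induction x using TensorProduct.induction_on with
  | zero => simp
  | tmul z h => simp [sigmaR]
  | add x y hx hy => simp [hx, hy]

/-- A weight one Hodge structure contains no nonzero real vector in `σ(F)`. -/
theorem eq_zero_of_one_tmul_mem_map_sigmaR {H : Type*} [AddCommGroup H] [Module ℝ H]
    {F : Submodule ℂ (ℂ ⊗[ℝ] H)} (hF : Disjoint F (F.map (sigmaR H))) {h : H}
    (hh : (1 : ℂ) ⊗ₜ[ℝ] h ∈ F.map (sigmaR H)) : h = 0 := by
  have hmem : (1 : ℂ) ⊗ₜ[ℝ] h ∈ F := by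
    obtain ⟨y, hy, hyh⟩ := hh
    have : y = 1 ⊗ₜ h := by rw [← sigmaR_one_tmul, ← hyh, sigmaR_sigmaR]
    exact this ▸ hy
  have h0 := Submodule.disjoint_def.mp hF _ hmem hh
  exact Module.FaithfullyFlat.tensorProduct_mk_injective (A := ℝ) (B := ℂ) H (by simpa using h0)

/-- A real pure tensor of type `(1,1)` vanishes. -/
theorem eq_zero_or_eq_zero_of_tmul_mem {H H' : Type*} [AddCommGroup H] [Module ℝ H]
    [AddCommGroup H'] [Module ℝ H']
    {F : Submodule ℂ (ℂ ⊗[ℝ] H)} {F' : Submodule ℂ (ℂ ⊗[ℝ] H')}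
    (hF : IsCompl F (F.map (sigmaR H))) (hF' : IsCompl F' (F'.map (sigmaR H')))
    {w : H} {x : H'}
    (h : distribR H H' ((1 : ℂ) ⊗ₜ (w ⊗ₜ x)) ∈
      tensorSub F (F'.map (sigmaR H')) ⊔ tensorSub (F.map (sigmaR H)) F') :
    w = 0 ∨ x = 0 := by
  let p := F.projectionOnto _ hF
  let q := F'.projectionOnto _ hF'
  have hle : tensorSub F (F'.map (sigmaR H')) ⊔ tensorSub (F.map (sigmaR H)) F' ≤
      LinearMap.ker (TensorProduct.map p q) := by
    refine sup_le (Submodule.map₂_le.mpr ?_) (Submodule.map₂_le.mpr ?_)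
    · intro m _ n hn
      have : q n = 0 := (Submodule.projectionOnto_apply_eq_zero_iff hF').mpr hn
      simp [this]
    · intro m hm n _
      have : p m = 0 := (Submodule.projectionOnto_apply_eq_zero_iff hF).mpr hm
      simp [this]
  have hpq : p (1 ⊗ₜ w) ⊗ₜ[ℂ] q (1 ⊗ₜ x) = 0 := by
    simpa [distribR] using hle h
  refine (tmul_eq_zero_or_eq_zero hpq).imp (fun h0 ↦ ?_) (fun h0 ↦ ?_)
  · exact eq_zero_of_one_tmul_mem_map_sigmaR hF.disjoint
      ((Submodule.projectionOnto_apply_eq_zero_iff hF).mp h0)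
  · exact eq_zero_of_one_tmul_mem_map_sigmaR hF'.disjoint
      ((Submodule.projectionOnto_apply_eq_zero_iff hF').mp h0)

/-- The real-coefficient form of Lemma 2.7: for real Hodge structures of weight 1 on
`H₀, H₁, H₂`, a class `u ∈ H₀ ⊗ H₁` of type `(1,1)` and classes `v₁, …, v_r ∈ H₁ ⊗ H₂` of
type `(1,1)`, the subspaces `(ℝ·u) ⊗ H₂` and `H₀ ⊗ span{v₁, …, v_r}` of `H₀ ⊗ H₁ ⊗ H₂`
intersect trivially. -/
theorem hodge_lemma_real
    (H₀ H₁ H₂ : Type*)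
    [AddCommGroup H₀] [Module ℝ H₀] [FiniteDimensional ℝ H₀]
    [AddCommGroup H₁] [Module ℝ H₁] [FiniteDimensional ℝ H₁]
    [AddCommGroup H₂] [Module ℝ H₂] [FiniteDimensional ℝ H₂]
    (F₀ : Submodule ℂ (ℂ ⊗[ℝ] H₀)) (F₁ : Submodule ℂ (ℂ ⊗[ℝ] H₁))
    (F₂ : Submodule ℂ (ℂ ⊗[ℝ] H₂))
    (hd₀ : IsCompl F₀ (F₀.map (sigmaR H₀)))
    (hd₁ : IsCompl F₁ (F₁.map (sigmaR H₁)))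
    (hd₂ : IsCompl F₂ (F₂.map (sigmaR H₂)))
    (u : H₀ ⊗[ℝ] H₁)
    (hu : distribR H₀ H₁ ((1 : ℂ) ⊗ₜ u) ∈
      tensorSub F₀ (F₁.map (sigmaR H₁)) ⊔ tensorSub (F₀.map (sigmaR H₀)) F₁)
    (r : ℕ) (v : Fin r → H₁ ⊗[ℝ] H₂)
    (hv : ∀ j, distribR H₁ H₂ ((1 : ℂ) ⊗ₜ v j) ∈
      tensorSub F₁ (F₂.map (sigmaR H₂)) ⊔ tensorSub (F₁.map (sigmaR H₁)) F₂) :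
    Submodule.span ℝ {z : (H₀ ⊗[ℝ] H₁) ⊗[ℝ] H₂ | ∃ x : H₂, z = u ⊗ₜ x} ⊓
      Submodule.span ℝ {z : (H₀ ⊗[ℝ] H₁) ⊗[ℝ] H₂ | ∃ (y : H₀) (j : Fin r),
        z = (TensorProduct.assoc ℝ H₀ H₁ H₂).symm (y ⊗ₜ v j)} = ⊥ := by
  rw [eq_bot_iff]
  rintro z ⟨hz₁, hz₂⟩
  obtain ⟨x, rfl⟩ : ∃ x : H₂, z = u ⊗ₜ x := by
    have hle : Submodule.span ℝ {z : (H₀ ⊗[ℝ] H₁) ⊗[ℝ] H₂ | ∃ x : H₂, z = u ⊗ₜ x} ≤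
        LinearMap.range (TensorProduct.mk ℝ (H₀ ⊗[ℝ] H₁) H₂ u) := by
      rw [Submodule.span_le]
      rintro _ ⟨x, rfl⟩
      exact ⟨x, rfl⟩
    obtain ⟨x, hx⟩ := hle hz₁
    exact ⟨x, hx.symm⟩
  let T : Submodule ℝ (H₁ ⊗[ℝ] H₂) :=
    ((tensorSub F₁ (F₂.map (sigmaR H₂)) ⊔ tensorSub (F₁.map (sigmaR H₁)) F₂).restrictScalars
      ℝ).comap ((distribR H₁ H₂).toLinearMap.restrictScalars ℝ ∘ₗ
        TensorProduct.mk ℝ ℂ (H₁ ⊗[ℝ] H₂) 1)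
  have hT (f : H₀ →ₗ[ℝ] ℝ) : contractLeftForm H₁ f u ⊗ₜ[ℝ] x ∈ T := by
    have hle : Submodule.span ℝ {z : (H₀ ⊗[ℝ] H₁) ⊗[ℝ] H₂ | ∃ (y : H₀) (j : Fin r),
        z = (TensorProduct.assoc ℝ H₀ H₁ H₂).symm (y ⊗ₜ v j)} ≤
        T.comap ((contractLeftForm H₁ f).rTensor H₂) := by
      rw [Submodule.span_le]
      rintro _ ⟨y, j, rfl⟩
      rw [SetLike.mem_coe, Submodule.mem_comap, rTensor_contractLeftForm_assoc_symm]
      exact T.smul_mem _ (hv j)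
    have hmem := Submodule.mem_comap.mp (hle hz₂)
    rwa [LinearMap.rTensor_tmul] at hmem
  have hw (f : H₀ →ₗ[ℝ] ℝ) : contractLeftForm H₁ f u = 0 ∨ x = 0 :=
    eq_zero_or_eq_zero_of_tmul_mem hd₁ hd₂ (hT f)
  rw [Submodule.mem_bot]
  by_cases hx : x = 0
  · rw [hx, TensorProduct.tmul_zero]
  · rw [eq_zero_of_forall_contractLeftForm fun f ↦ (hw f).resolve_right hx,
      TensorProduct.zero_tmul]
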